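/- Let ρ, ρ₁, ρ₂ be real with ρ₁² < 1, ρ₂² < 1, and 1 − ρ² − ρ₁² − ρ₂² + 2ρρ₁ρ₂ ≥ 0, let P₁, P₂ ≥ 0, N ≥ 0, and C₁, C₂, C₁₂, C₂₁ real. Set φ₁ = (1−ρ₁²)(1+N) + (1 − ρ² − ρ₁² − ρ₂² + 2ρρ₁ρ₂)P₂ and φ₂ = (1−ρ₂²)(1+N) + (1 − ρ² − ρ₁² − ρ₂² + 2ρρ₁ρ₂)P₁. Then a real number R satisfies R ≤ C₁ + C₂ − (1/2)·log₂(2^{2(R−C₁₂−C₂₁)} + N) − (1/2)·log₂(1+N) + (1/2)·log₂(φ₁φ₂/((1−ρ₁²)(1−ρ₂²))) if and only if R ≤ (1/2)·log₂( √( 2^{2(C₁+C₂+C₁₂+C₂₁)}·φ₁φ₂/((1−ρ₁²)(1−ρ₂²)(1+N)) + 2^{4(C₁₂+C₂₁)}N²/4 ) − 2^{2(C₁₂+C₂₁)}N/2 ). -/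

import Mathlib

open Real

lemma le_half_logb_two_iff {x y : ℝ} (hy : 0 < y) :
    x ≤ (1 / 2) * logb 2 y ↔ (2 : ℝ) ^ (2 * x) ≤ y := by
  rw [← le_logb_iff_rpow_le one_lt_two hy]
  constructor <;> intro h <;> linarith

lemma le_sqrt_sub_iff_sq_add_le {T m A : ℝ} (hT : 0 < T) (hm : 0 ≤ m) :
    T ≤ √(A + m ^ 2) - m ↔ T ^ 2 + 2 * m * T ≤ A := by
  rw [le_sub_iff_add_le, le_sqrt' (by positivity), add_sq]
  constructor <;> intro h <;> linarith

lemma le_sub_logb_add_iff {N K C S R : ℝ} (hN : 0 ≤ N) (hK : 0 < K) :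
    R ≤ C - (1 / 2) * logb 2 ((2 : ℝ) ^ (2 * (R - S)) + N) - (1 / 2) * logb 2 (1 + N)
        + (1 / 2) * logb 2 K ↔
      R ≤ (1 / 2) * logb 2 (√((2 : ℝ) ^ (2 * (C + S)) * K / (1 + N)
        + ((2 : ℝ) ^ (2 * S) * N / 2) ^ 2) - (2 : ℝ) ^ (2 * S) * N / 2) := by
  have hb : 0 < (2 : ℝ) ^ (2 * S) := by positivity
  have hc : 0 < (2 : ℝ) ^ (2 * C) := by positivity
  have hT : 0 < (2 : ℝ) ^ (2 * R) := by positivity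
  have hN' : 0 < 1 + N := by positivity
  have hm : 0 ≤ (2 : ℝ) ^ (2 * S) * N / 2 := by positivity
  have hRS : (2 : ℝ) ^ (2 * (R - S)) = 2 ^ (2 * R) / 2 ^ (2 * S) := by
    rw [mul_sub, rpow_sub two_pos]
  have hCS : (2 : ℝ) ^ (2 * (C + S)) = 2 ^ (2 * C) * 2 ^ (2 * S) := by
    rw [mul_add, rpow_add two_pos]
  have hlogC : logb 2 ((2 : ℝ) ^ (2 * C)) = 2 * C := logb_rpow two_pos (by norm_num)
  have hlogR : logb 2 ((2 : ℝ) ^ (2 * R)) = 2 * R := logb_rpow two_pos (by norm_num)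
  rw [hRS, hCS]
  generalize (2 : ℝ) ^ (2 * S) = b at *
  generalize (2 : ℝ) ^ (2 * C) = c at *
  have hpos : 0 < √(c * b * K / (1 + N) + (b * N / 2) ^ 2) - b * N / 2 := by
    rw [sub_pos]
    exact lt_sqrt_of_sq_lt (lt_add_of_pos_left _ (by positivity))
  rw [le_half_logb_two_iff hpos, le_sqrt_sub_iff_sq_add_le hT hm]
  generalize (2 : ℝ) ^ (2 * R) = T at *
  have hTbN : 0 < T / b + N := by positivity
  trans logb 2 (T * (T / b + N) * (1 + N)) ≤ logb 2 (c * K)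
  · rw [logb_mul (by positivity) hN'.ne', logb_mul hT.ne' hTbN.ne', logb_mul hc.ne' hK.ne',
      hlogC, hlogR]
    constructor <;> intro h <;> linarith
  · rw [logb_le_logb one_lt_two (by positivity) (by positivity), le_div_iff₀ hN',
      ← mul_le_mul_iff_left₀ hb]
    have : T * (T / b + N) * (1 + N) * b = (T ^ 2 + 2 * (b * N / 2) * T) * (1 + N) := by
      field_simp
    rw [this, mul_right_comm c K b]

open Real

theorem remark_reformulation (ρ ρ₁ ρ₂ P₁ P₂ N C₁ C₂ C₁₂ C₂₁ R : ℝ)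
    (hρ₁ : ρ₁ ^ 2 < 1) (hρ₂ : ρ₂ ^ 2 < 1)
    (hadm : 1 - ρ ^ 2 - ρ₁ ^ 2 - ρ₂ ^ 2 + 2 * ρ * ρ₁ * ρ₂ ≥ 0)
    (hP₁ : 0 ≤ P₁) (hP₂ : 0 ≤ P₂) (hN : 0 ≤ N) :
    let φ₁ := (1 - ρ₁ ^ 2) * (1 + N) +
      (1 - ρ ^ 2 - ρ₁ ^ 2 - ρ₂ ^ 2 + 2 * ρ * ρ₁ * ρ₂) * P₂
    let φ₂ := (1 - ρ₂ ^ 2) * (1 + N) +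
      (1 - ρ ^ 2 - ρ₁ ^ 2 - ρ₂ ^ 2 + 2 * ρ * ρ₁ * ρ₂) * P₁
    (R ≤ C₁ + C₂ - (1 / 2) * logb 2 ((2 : ℝ) ^ (2 * (R - C₁₂ - C₂₁)) + N)
        - (1 / 2) * logb 2 (1 + N)
        + (1 / 2) * logb 2 (φ₁ * φ₂ / ((1 - ρ₁ ^ 2) * (1 - ρ₂ ^ 2)))) ↔
      R ≤ (1 / 2) * logb 2
        (Real.sqrt ((2 : ℝ) ^ (2 * (C₁ + C₂ + C₁₂ + C₂₁)) * φ₁ * φ₂ /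
              ((1 - ρ₁ ^ 2) * (1 - ρ₂ ^ 2) * (1 + N)) +
            (2 : ℝ) ^ (4 * (C₁₂ + C₂₁)) * N ^ 2 / 4)
          - (2 : ℝ) ^ (2 * (C₁₂ + C₂₁)) * N / 2) := by
  intro φ₁ φ₂
  have h₁ : 0 < 1 - ρ₁ ^ 2 := sub_pos.mpr hρ₁
  have h₂ : 0 < 1 - ρ₂ ^ 2 := sub_pos.mpr hρ₂
  have hφ₁ : 0 < φ₁ := add_pos_of_pos_of_nonneg (by positivity) (mul_nonneg hadm hP₂)
  have hφ₂ : 0 < φ₂ := add_pos_of_pos_of_nonneg (by positivity) (mul_nonneg hadm hP₁)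
  have hK : 0 < φ₁ * φ₂ / ((1 - ρ₁ ^ 2) * (1 - ρ₂ ^ 2)) := by positivity
  have hsq : (2 : ℝ) ^ (4 * (C₁₂ + C₂₁)) * N ^ 2 / 4
      = ((2 : ℝ) ^ (2 * (C₁₂ + C₂₁)) * N / 2) ^ 2 := by
    have : (2 : ℝ) ^ (4 * (C₁₂ + C₂₁)) = ((2 : ℝ) ^ (2 * (C₁₂ + C₂₁))) ^ 2 := by
      rw [sq, ← rpow_add two_pos]
      ring_nf
    rw [this]
    ring
  have hdiv : (2 : ℝ) ^ (2 * (C₁ + C₂ + C₁₂ + C₂₁)) * φ₁ * φ₂ /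
        ((1 - ρ₁ ^ 2) * (1 - ρ₂ ^ 2) * (1 + N))
      = (2 : ℝ) ^ (2 * (C₁ + C₂ + (C₁₂ + C₂₁))) *
        (φ₁ * φ₂ / ((1 - ρ₁ ^ 2) * (1 - ρ₂ ^ 2))) / (1 + N) := by
    rw [mul_assoc, ← div_div, mul_div_assoc, add_assoc (C₁ + C₂)]
  rw [hsq, hdiv, sub_sub R]
  exact le_sub_logb_add_iff hN hK
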